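/- arXiv:1812.08965 — 3 statements merged into one kernel-verified Lean document; each statement's English description precedes it below -/
import Mathlib

section
/- (FDR-linking theorem.) Under arbitrary dependence of the p-values (only super-uniformity of the null p-values is assumed), the Benjamini–Hochberg procedure at level α ∈ (0,1) satisfies FDR ≤ π_0 α + π_0 α ∫_{π_0 α}^{1} FDR_0(x)/x² dx. -/
open MeasureTheory Finset

attribute [local instance] Classical.propDecidable

/-- Number of rejections of the Benjamini–Hochberg (step-up) procedure at level `α`
applied to the family of p-values `p` indexed by `ι`: the largest `j` such that the
`j`-th smallest p-value is at most `α j / n` (equivalently, at least `j` of the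
p-values are at most `α j / n`), and `0` if there is no such `j ≥ 1`. -/
noncomputable def bhNumRejections {ι : Type*} [Fintype ι] (α : ℝ) (p : ι → ℝ) : ℕ :=
  Nat.findGreatest
    (fun j => j ≤ (Finset.univ.filter (fun i => p i ≤ α * (j : ℝ) / (Fintype.card ι : ℝ))).card)
    (Fintype.card ι)

/-- False discovery proportion `V / max{R, 1}` of the BH procedure at level `α`
with set of true null hypotheses `N₀`. -/
noncomputable def bhFDP {ι : Type*} [Fintype ι] (α : ℝ) (N₀ : Finset ι) (p : ι → ℝ) : ℝ :=
  ((N₀.filter (fun i => p i ≤ α * (bhNumRejections α p : ℝ) / (Fintype.card ι : ℝ))).card : ℝ) /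
    ((max (bhNumRejections α p) 1 : ℕ) : ℝ)

/-- False discovery rate (expected FDP) of the BH procedure at level `α`. -/
noncomputable def bhFDR {Ω : Type*} [MeasurableSpace Ω] {ι : Type*} [Fintype ι]
    (μ : Measure Ω) (α : ℝ) (N₀ : Finset ι) (p : ι → Ω → ℝ) : ℝ :=
  ∫ ω, bhFDP α N₀ (fun i => p i ω) ∂μ

lemma card_filter_le_bhNumRejections {ι : Type*} [Fintype ι] {α : ℝ} (hα : 0 ≤ α) (p : ι → ℝ) :
    (univ.filter (fun i => p i ≤ α * (bhNumRejections α p : ℝ) / (Fintype.card ι : ℝ))).card ≤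
      bhNumRejections α p := by
  by_contra! h
  refine absurd ?_ (not_le.2 h)
  conv_rhs => rw [bhNumRejections]
  refine Nat.le_findGreatest (card_le_univ _) (card_le_card ?_)
  refine monotone_filter_right _ fun i _ hi => hi.trans ?_
  gcongr

lemma bhFDP_nonneg {ι : Type*} [Fintype ι] (α : ℝ) (N₀ : Finset ι) (p : ι → ℝ) :
    0 ≤ bhFDP α N₀ p := by
  unfold bhFDP
  positivity

lemma card_filter_null_le_bhNumRejections {ι : Type*} [Fintype ι] {α : ℝ} (hα : 0 ≤ α)
    (N₀ : Finset ι) (p : ι → ℝ) :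
    (N₀.filter (fun i => p i ≤ α * (bhNumRejections α p : ℝ) / (Fintype.card ι : ℝ))).card ≤
      bhNumRejections α p :=
  (card_le_card (filter_subset_filter _ (subset_univ _))).trans
    (card_filter_le_bhNumRejections hα p)

lemma bhFDP_le_one {ι : Type*} [Fintype ι] {α : ℝ} (hα : 0 ≤ α) (N₀ : Finset ι) (p : ι → ℝ) :
    bhFDP α N₀ p ≤ 1 := by
  unfold bhFDP
  refine div_le_one_of_le₀ ?_ (by positivity)
  exact_mod_cast (card_filter_null_le_bhNumRejections hα N₀ p).trans (le_max_left _ _)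

/-- If at least `j ≥ 1` p-values lie below the `j`-th critical value, then BH rejects something,
so with all hypotheses null its false discovery proportion is at least one. -/
lemma one_le_bhFDP_univ {ι : Type*} [Fintype ι] {α : ℝ} {p : ι → ℝ} {j : ℕ} (hj : 0 < j)
    (h : j ≤ (univ.filter (fun i => p i ≤ α * (j : ℝ) / (Fintype.card ι : ℝ))).card) :
    1 ≤ bhFDP α univ p := by
  have hjR : j ≤ bhNumRejections α p :=
    Nat.le_findGreatest (h.trans (card_le_univ _)) h
  have hR : 0 < bhNumRejections α p := hj.trans_le hjR
  have hspec : bhNumRejections α p ≤ (univ.filter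
      (fun i => p i ≤ α * (bhNumRejections α p : ℝ) / (Fintype.card ι : ℝ))).card :=
    Nat.findGreatest_spec
      (P := fun j => j ≤ (univ.filter (fun i => p i ≤ α * (j : ℝ) / (Fintype.card ι : ℝ))).card)
      (h.trans (card_le_univ _)) h
  unfold bhFDP
  rw [max_eq_left (Nat.one_le_iff_ne_zero.2 hR.ne'), one_le_div (by exact_mod_cast hR)]
  exact_mod_cast hspec

lemma measurable_card_filter_le {Z ι : Type*} [MeasurableSpace Z] (s : Finset ι)
    {q : ι → Z → ℝ} (hq : ∀ i, Measurable (q i)) {b : Z → ℝ} (hb : Measurable b) :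
    Measurable fun z => (s.filter (fun i => q i z ≤ b z)).card := by
  simp only [card_filter]
  exact Finset.measurable_fun_sum _ fun i _ =>
    Measurable.ite (measurableSet_le (hq i) hb) measurable_const measurable_const

lemma measurable_bhNumRejections {Z ι : Type*} [MeasurableSpace Z] [Fintype ι] {a : Z → ℝ}
    (ha : Measurable a) {q : ι → Z → ℝ} (hq : ∀ i, Measurable (q i)) :
    Measurable fun z => bhNumRejections (a z) (fun i => q i z) := by
  unfold bhNumRejections
  exact measurable_findGreatest fun k _ => measurableSet_le measurable_const
    (measurable_card_filter_le _ hq ((ha.mul_const _).div_const _))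

lemma measurable_bhFDP {Z ι : Type*} [MeasurableSpace Z] [Fintype ι] {a : Z → ℝ}
    (ha : Measurable a) (N₀ : Finset ι) {q : ι → Z → ℝ} (hq : ∀ i, Measurable (q i)) :
    Measurable fun z => bhFDP (a z) N₀ (fun i => q i z) := by
  have hR := measurable_bhNumRejections ha hq
  unfold bhFDP
  refine Measurable.div ?_ ?_
  · exact measurable_from_top.comp (measurable_card_filter_le N₀ hq
      ((ha.mul (measurable_from_top.comp hR)).div_const _))
  · exact measurable_from_top.comp (hR.max measurable_const)

lemma integral_one_div_sq {s : ℝ} (hs : 0 < s) (hs1 : s ≤ 1) :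
    ∫ x in s..1, 1 / x ^ 2 = 1 / s - 1 := by
  have h0 : ∀ x ∈ Set.uIcc s 1, x ≠ 0 := fun x hx => by
    rw [Set.uIcc_of_le hs1] at hx
    exact (hs.trans_le hx.1).ne'
  have hd : ∀ x ∈ Set.uIcc s 1, HasDerivAt (fun x : ℝ => -x⁻¹) (1 / x ^ 2) x := fun x hx => by
    have := (hasDerivAt_inv (h0 x hx)).fun_neg
    simpa using this
  rw [intervalIntegral.integral_eq_sub_of_hasDerivAt hd]
  · simp; ring
  · refine ContinuousOn.intervalIntegrable ?_
    exact continuousOn_const.div (by fun_prop) fun x hx => pow_ne_zero 2 (h0 x hx)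

lemma intervalIntegrable_bhFDP_div_sq {ι : Type*} [Fintype ι] (N₀ : Finset ι) (p : ι → ℝ)
    {c d : ℝ} (hc : 0 < c) (hcd : c ≤ d) :
    IntervalIntegrable (fun x => bhFDP x N₀ p / x ^ 2) volume c d := by
  rw [intervalIntegrable_iff_integrableOn_Ioc_of_le hcd]
  refine Measure.integrableOn_of_bounded (M := 1 / c ^ 2) (by simp)
    ((measurable_bhFDP measurable_id N₀ fun _ => measurable_const).div
      (measurable_id.pow_const 2)).aestronglyMeasurable ?_
  refine (ae_restrict_iff' measurableSet_Ioc).2 (.of_forall fun x hx => ?_)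
  have hx0 : 0 < x := hc.trans hx.1
  rw [Real.norm_of_nonneg (div_nonneg (bhFDP_nonneg _ _ _) (sq_nonneg x))]
  exact div_le_div₀ zero_le_one (bhFDP_le_one hx0.le _ _) (by positivity)
    (pow_le_pow_left₀ hc.le hx.1.le 2)

/-- Pointwise form of the FDR-linking bound. -/
lemma bhFDP_le_integral_bhFDP_null {n : ℕ} (hn : 0 < n) (N₀ : Finset (Fin n)) (hN₀ : 0 < N₀.card)
    {α : ℝ} (hα : 0 < α) (hα1 : α < 1) (p : Fin n → ℝ) :
    bhFDP α N₀ p ≤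
      (N₀.card : ℝ) / n * α +
        (N₀.card : ℝ) / n * α *
          ∫ x in ((N₀.card : ℝ) / n * α)..1,
            bhFDP x (univ : Finset {i // i ∈ N₀}) (fun i => p i.1) / x ^ 2 := by
  have hn' : (0 : ℝ) < n := by exact_mod_cast hn
  have hm' : (0 : ℝ) < N₀.card := by exact_mod_cast hN₀
  have hmn : (N₀.card : ℝ) ≤ n := by exact_mod_cast (card_le_univ N₀).trans_eq (Fintype.card_fin n)
  set c : ℝ := (N₀.card : ℝ) / n * α with hc
  have hc0 : 0 < c := by positivity
  have hc1 : c ≤ 1 := mul_le_one₀ ((div_le_one hn').2 hmn) hα.le hα1.le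
  have hg0 : ∀ x, 0 ≤ bhFDP x (univ : Finset {i // i ∈ N₀}) (fun i => p i.1) / x ^ 2 :=
    fun x => div_nonneg (bhFDP_nonneg _ _ _) (sq_nonneg x)
  have hI0 : 0 ≤ ∫ x in c..1, bhFDP x (univ : Finset {i // i ∈ N₀}) (fun i => p i.1) / x ^ 2 :=
    intervalIntegral.integral_nonneg hc1 fun x _ => hg0 x
  have hVR := card_filter_null_le_bhNumRejections hα.le N₀ p
  obtain ⟨V, hV⟩ : ∃ V, V =
      (N₀.filter (fun i => p i ≤ α * (bhNumRejections α p : ℝ) / (Fintype.card (Fin n) : ℝ))).card :=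
    ⟨_, rfl⟩
  obtain ⟨R, hR⟩ : ∃ R, R = bhNumRejections α p := ⟨_, rfl⟩
  have hF : bhFDP α N₀ p = (V : ℝ) / ((max R 1 : ℕ) : ℝ) := by
    rw [hV, hR, bhFDP]
  rw [← hV, ← hR] at hVR
  rw [hF]
  rcases Nat.eq_zero_or_pos V with h0 | hVpos
  · simp only [h0, Nat.cast_zero, zero_div]
    positivity
  have hRpos : 0 < R := hVpos.trans_le hVR
  have hV' : (0 : ℝ) < V := by exact_mod_cast hVpos
  have hR' : (0 : ℝ) < R := by exact_mod_cast hRpos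
  have hVR' : (V : ℝ) ≤ R := by exact_mod_cast hVR
  rw [max_eq_left (Nat.one_le_iff_ne_zero.2 hRpos.ne')]
  set s : ℝ := c * (R / V) with hs
  have hs0 : 0 < s := by positivity
  have hcs : c ≤ s := le_mul_of_one_le_right hc0.le ((one_le_div hV').2 hVR')
  have hVs : (V : ℝ) / R = c * (1 / s) := by
    rw [hs]; field_simp
  rcases le_total s 1 with hs1 | hs1
  · have hone : ∀ x, s ≤ x →
        1 ≤ bhFDP x (univ : Finset {i // i ∈ N₀}) (fun i => p i.1) := fun x hx => by
      refine one_le_bhFDP_univ hVpos ?_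
      rw [Fintype.card_coe]
      have hle : α * (R : ℝ) / n ≤ x * V / N₀.card := by
        have : α * (R : ℝ) / n = s * V / N₀.card := by
          rw [hs, hc]; field_simp
        rw [this]
        gcongr
      conv_lhs => rw [hV, ← hR, Fintype.card_fin]
      refine card_le_card_of_surjOn (fun i => i.1) fun i hi => ?_
      simp only [coe_filter, Set.mem_ofPred_eq] at hi
      exact ⟨⟨i, hi.1⟩, by simpa using hi.2.trans hle, rfl⟩
    have h1 : 1 / s - 1 ≤
        ∫ x in s..1, bhFDP x (univ : Finset {i // i ∈ N₀}) (fun i => p i.1) / x ^ 2 := by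
      rw [← integral_one_div_sq hs0 hs1]
      refine intervalIntegral.integral_mono_on hs1 ?_
        (intervalIntegrable_bhFDP_div_sq _ _ hs0 hs1) fun x hx => ?_
      · refine ContinuousOn.intervalIntegrable ?_
        refine continuousOn_const.div (by fun_prop) fun x hx => pow_ne_zero 2 ?_
        rw [Set.uIcc_of_le hs1] at hx
        exact (hs0.trans_le hx.1).ne'
      · exact div_le_div_of_nonneg_right (hone x hx.1) (sq_nonneg x)
    have h2 : (∫ x in s..1, bhFDP x (univ : Finset {i // i ∈ N₀}) (fun i => p i.1) / x ^ 2) ≤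
        ∫ x in c..1, bhFDP x (univ : Finset {i // i ∈ N₀}) (fun i => p i.1) / x ^ 2 :=
      intervalIntegral.integral_mono_interval hcs hs1 le_rfl (.of_forall hg0)
        (intervalIntegrable_bhFDP_div_sq _ _ hc0 hc1)
    have h3 := mul_le_mul_of_nonneg_left (h1.trans h2) hc0.le
    rw [hVs]
    linarith
  · have : c * (1 / s) ≤ c := mul_le_of_le_one_right hc0.le ((div_le_one hs0).2 hs1)
    have := mul_nonneg hc0.le hI0
    linarith

lemma integrable_bhFDP_div_sq_prod {Ω ι : Type*} [MeasurableSpace Ω] [Fintype ι] (μ : Measure Ω)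
    [IsFiniteMeasure μ] (N₀ : Finset ι) {p : ι → Ω → ℝ} (hp : ∀ i, Measurable (p i))
    {c : ℝ} (hc : 0 < c) (d : ℝ) :
    Integrable (fun z : Ω × ℝ => bhFDP z.2 N₀ (fun i => p i z.1) / z.2 ^ 2)
      (μ.prod (volume.restrict (Set.Ioc c d))) := by
  refine Integrable.of_bound (C := 1 / c ^ 2)
    ((measurable_bhFDP measurable_snd N₀ fun i => (hp i).comp measurable_fst).div
      (measurable_snd.pow_const 2)).aestronglyMeasurable ?_
  have hae : ∀ᵐ z ∂(μ.prod (volume.restrict (Set.Ioc c d))), z.2 ∈ Set.Ioc c d :=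
    Measure.quasiMeasurePreserving_snd.ae (ae_restrict_mem measurableSet_Ioc)
  filter_upwards [hae] with z hz
  have hz0 : 0 < z.2 := hc.trans hz.1
  rw [Real.norm_of_nonneg (div_nonneg (bhFDP_nonneg _ _ _) (sq_nonneg _))]
  exact div_le_div₀ zero_le_one (bhFDP_le_one hz0.le _ _) (by positivity)
    (pow_le_pow_left₀ hc.le hz.1.le 2)

/-- **The FDR-linking theorem.** Under arbitrary dependence of the p-values (only
super-uniformity of the null p-values is assumed), the BH procedure at level
`α ∈ (0,1)` satisfies `FDR ≤ π₀ α + π₀ α ∫_{π₀ α}^1 FDR₀(x)/x² dx`, where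
`FDR₀(x)` is the FDR of the BH procedure at level `x` applied to the null
p-values alone. -/
theorem fdr_linking
    {Ω : Type*} [MeasurableSpace Ω] (μ : Measure Ω) [IsProbabilityMeasure μ]
    {n : ℕ} (hn : 0 < n) (p : Fin n → Ω → ℝ)
    (hmeas : ∀ i, Measurable (p i))
    (hrange : ∀ i ω, p i ω ∈ Set.Icc (0:ℝ) 1)
    (N₀ : Finset (Fin n)) (hN₀ : 0 < N₀.card)
    (hnull : ∀ i ∈ N₀, ∀ t ∈ Set.Icc (0:ℝ) 1, μ {ω | p i ω ≤ t} ≤ ENNReal.ofReal t)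
    {α : ℝ} (hα : 0 < α) (hα1 : α < 1) :
    bhFDR μ α N₀ p ≤
      (N₀.card : ℝ) / n * α +
        (N₀.card : ℝ) / n * α *
          ∫ x in ((N₀.card : ℝ) / n * α)..1,
            (bhFDR μ x (Finset.univ : Finset {i // i ∈ N₀}) (fun i ω => p i.1 ω)) / x ^ 2 := by
  have hn' : (0 : ℝ) < n := by exact_mod_cast hn
  have hm' : (0 : ℝ) < N₀.card := by exact_mod_cast hN₀
  have hmn : (N₀.card : ℝ) ≤ n := by exact_mod_cast (card_le_univ N₀).trans_eq (Fintype.card_fin n)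
  have hpt := fun ω => bhFDP_le_integral_bhFDP_null hn N₀ hN₀ hα hα1 (fun i => p i ω)
  set c : ℝ := (N₀.card : ℝ) / n * α with hc
  have hc0 : 0 < c := by positivity
  have hc1 : c ≤ 1 := mul_le_one₀ ((div_le_one hn').2 hmn) hα.le hα1.le
  have hprod := integrable_bhFDP_div_sq_prod μ (univ : Finset {i // i ∈ N₀})
    (p := fun i ω => p i.1 ω) (fun i => hmeas i.1) hc0 1
  have hswap : (∫ x in c..1,
      (bhFDR μ x (univ : Finset {i // i ∈ N₀}) (fun i ω => p i.1 ω)) / x ^ 2) =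
      ∫ ω, (∫ x in c..1, bhFDP x (univ : Finset {i // i ∈ N₀}) (fun i => p i.1 ω) / x ^ 2) ∂μ := by
    simp only [intervalIntegral.integral_of_le hc1, bhFDR, ← integral_div]
    exact (integral_integral_swap hprod).symm
  have hint : Integrable (fun ω => ∫ x in c..1,
      bhFDP x (univ : Finset {i // i ∈ N₀}) (fun i => p i.1 ω) / x ^ 2) μ := by
    simp only [intervalIntegral.integral_of_le hc1]
    exact hprod.integral_prod_left
  have hL : Integrable (fun ω => bhFDP α N₀ (fun i => p i ω)) μ := by
    refine Integrable.of_bound (C := 1)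
      (measurable_bhFDP measurable_const N₀ hmeas).aestronglyMeasurable (.of_forall fun ω => ?_)
    rw [Real.norm_of_nonneg (bhFDP_nonneg _ _ _)]
    exact bhFDP_le_one hα.le _ _
  rw [hswap]
  refine (integral_mono hL ((integrable_const c).add (hint.const_mul c)) hpt).trans_eq ?_
  simp only [Pi.add_apply]
  rw [integral_add (integrable_const c) (hint.const_mul c), integral_const, probReal_univ, one_smul,
    integral_const_mul]
end

section
/- If the p-values satisfy the PRDN property, then every multiple testing procedure compliant at level α ∈ (0,1) satisfies the strengthened bound FDR ≤ π_0 α + π_0 α·log(1/(π_0 α)), where π_0 = n_0/n is the true null proportion. -/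
open MeasureTheory Finset

attribute [local instance] Classical.propDecidable

/-- False discovery proportion `V / max{R,1}` of a multiple testing procedure with
rejection set `Rset`, where `N₀` is the set of true null hypotheses. -/
noncomputable def procFDP {ι : Type*} (N₀ Rset : Finset ι) : ℝ :=
  ((Rset ∩ N₀).card : ℝ) / ((max Rset.card 1 : ℕ) : ℝ)

/-- A rejection set `Rset` is compliant at level `α` if every rejected p-value `p j`
satisfies `p j ≤ α ⋅ |Rset| / n`. -/
def IsCompliant {ι : Type*} [Fintype ι] (α : ℝ) (p : ι → ℝ) (Rset : Finset ι) : Prop :=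
  ∀ j ∈ Rset, p j ≤ α * (Rset.card : ℝ) / (Fintype.card ι : ℝ)

/-- An increasing subset `D` of the cube `[0,1]^ι`: membership is preserved when
coordinates increase (while staying at most 1). -/
def IsIncreasingSet {ι : Type*} (D : Set (ι → ℝ)) : Prop :=
  (∀ x ∈ D, ∀ i, x i ∈ Set.Icc (0:ℝ) 1) ∧
    ∀ x ∈ D, ∀ y : ι → ℝ, (∀ i, x i ≤ y i) → (∀ i, y i ≤ 1) → y ∈ D

/-- Positive regression dependence of the random vector `q`: for every increasing set
`D` and every coordinate `i`, the conditional probability `P(q ∈ D ∣ q i ≤ t)` is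
non-decreasing in `t ∈ (0,1]` (stated in cross-multiplied form, so that no division
by a possibly vanishing probability occurs). -/
def PRD {Ω : Type*} [MeasurableSpace Ω] {ι : Type*} (μ : Measure Ω) (q : ι → Ω → ℝ) : Prop :=
  ∀ D : Set (ι → ℝ), IsIncreasingSet D → ∀ i : ι, ∀ s t : ℝ, 0 < s → s ≤ t → t ≤ 1 →
    μ ({ω | (fun j => q j ω) ∈ D} ∩ {ω | q i ω ≤ s}) * μ {ω | q i ω ≤ t} ≤
      μ ({ω | (fun j => q j ω) ∈ D} ∩ {ω | q i ω ≤ t}) * μ {ω | q i ω ≤ s}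

/-- PRDN (positive regression dependence within nulls): the subvector of null
p-values `(p i)_{i ∈ N₀}` satisfies PRD. -/
def PRDN {Ω : Type*} [MeasurableSpace Ω] {n : ℕ} (μ : Measure Ω)
    (N₀ : Finset (Fin n)) (p : Fin n → Ω → ℝ) : Prop :=
  PRD μ (fun (i : {i // i ∈ N₀}) ω => p i.1 ω)

/-- If every point of `E` lies in at least `k` of the sets `A i`, then `k` times the measure
of `E` is at most the sum of the measures of the sets `E ∩ A i`. -/
lemma nsmul_measureReal_le_sum_inter {Ω : Type*} [MeasurableSpace Ω] {ι : Type*} [Fintype ι]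
    (μ : Measure Ω) [IsFiniteMeasure μ] {E : Set Ω} (hE : MeasurableSet E)
    {A : ι → Set Ω} (hA : ∀ i, MeasurableSet (A i)) {k : ℕ}
    (h : ∀ ω ∈ E, k ≤ (Finset.univ.filter (fun i => ω ∈ A i)).card) :
    (k : ℝ) * μ.real E ≤ ∑ i, μ.real (E ∩ A i) := by
  have hint : ∀ S : Set Ω, MeasurableSet S → Integrable (S.indicator (1 : Ω → ℝ)) μ :=
    fun S hS => (integrable_const (1 : ℝ)).indicator hS
  have hL : (k : ℝ) * μ.real E = ∫ ω, (k : ℝ) * E.indicator (1 : Ω → ℝ) ω ∂μ := by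
    rw [integral_const_mul, integral_indicator_one hE]
  have hR : ∑ i, μ.real (E ∩ A i) = ∫ ω, ∑ i, (E ∩ A i).indicator (1 : Ω → ℝ) ω ∂μ := by
    rw [integral_finsetSum _ fun i _ => hint _ (hE.inter (hA i))]
    exact Finset.sum_congr rfl fun i _ => (integral_indicator_one (hE.inter (hA i))).symm
  rw [hL, hR]
  refine integral_mono ((hint E hE).const_mul _)
    (integrable_finsetSum _ fun i _ => hint _ (hE.inter (hA i))) fun ω => ?_
  by_cases hω : ω ∈ E
  · have := h ω hω
    simpa [Set.indicator_apply, hω] using this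
  · simp [hω]

/-- The points of the cube `[0,1]^ι` at which, for every `j > k`, fewer than `j` coordinates
are at most `β j / m`, where `m` is the number of coordinates; equivalently, the step-up
procedure at level `β` makes at most `k` rejections. -/
def stepUpLeSet {ι : Type*} [Fintype ι] (β : ℝ) (k : ℕ) : Set (ι → ℝ) :=
  {x | (∀ i, x i ∈ Set.Icc (0 : ℝ) 1) ∧ ∀ j ∈ Finset.Ioc k (Fintype.card ι),
    (Finset.univ.filter (fun i => x i ≤ β * (j : ℝ) / (Fintype.card ι : ℝ))).card < j}

lemma isIncreasingSet_stepUpLeSet {ι : Type*} [Fintype ι] (β : ℝ) (k : ℕ) :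
    IsIncreasingSet (stepUpLeSet (ι := ι) β k) := by
  refine ⟨fun x hx => hx.1, fun x hx y hxy hy => ⟨fun i => ⟨(hx.1 i).1.trans (hxy i), hy i⟩,
    fun j hj => lt_of_le_of_lt (Finset.card_le_card ?_) (hx.2 j hj)⟩⟩
  intro i hi
  simp only [Finset.mem_filter, Finset.mem_univ, true_and] at hi ⊢
  exact (hxy i).trans hi

lemma stepUpLeSet_subset_succ {ι : Type*} [Fintype ι] (β : ℝ) (k : ℕ) :
    stepUpLeSet (ι := ι) β k ⊆ stepUpLeSet β (k + 1) := fun _ hx =>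
  ⟨hx.1, fun j hj => hx.2 j (by simp only [Finset.mem_Ioc] at hj ⊢; omega)⟩

lemma le_card_of_mem_stepUpLeSet_diff {ι : Type*} [Fintype ι] {β : ℝ} {k : ℕ} {x : ι → ℝ}
    (hx : x ∈ stepUpLeSet β (k + 1)) (hx' : x ∉ stepUpLeSet β k) :
    k + 1 ≤ (Finset.univ.filter
      (fun i => x i ≤ β * ((k + 1 : ℕ) : ℝ) / (Fintype.card ι : ℝ))).card := by
  by_contra! hlt
  refine hx' ⟨hx.1, fun j hj => ?_⟩
  rcases eq_or_ne j (k + 1) with rfl | hne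
  · exact hlt
  · exact hx.2 j (by simp only [Finset.mem_Ioc] at hj ⊢; omega)

lemma measurableSet_stepUpLeSet {ι : Type*} [Fintype ι] (β : ℝ) (k : ℕ) :
    MeasurableSet (stepUpLeSet (ι := ι) β k) := by
  have hcard : ∀ t : ℝ, Measurable fun x : ι → ℝ =>
      (Finset.univ.filter (fun i => x i ≤ t)).card := by
    intro t
    simp only [Finset.card_filter]
    refine Finset.measurable_sum _ fun i _ => Measurable.ite ?_ measurable_const measurable_const
    exact measurableSet_le (measurable_pi_apply i) measurable_const
  have hset : stepUpLeSet (ι := ι) β k = (⋂ i, (fun x : ι → ℝ => x i) ⁻¹' Set.Icc 0 1) ∩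
      ⋂ j ∈ Finset.Ioc k (Fintype.card ι), {x : ι → ℝ |
        (Finset.univ.filter (fun i => x i ≤ β * (j : ℝ) / (Fintype.card ι : ℝ))).card < j} := by
    ext x
    simp [stepUpLeSet]
  rw [hset]
  exact (MeasurableSet.iInter fun i => measurable_pi_apply i measurableSet_Icc).inter
    (Finset.measurableSet_biInter _ fun j _ => measurableSet_lt (hcard _) measurable_const)

/-- Positive regression dependence in terms of conditional probabilities, with the convention
`x / 0 = 0`. -/
lemma PRD.div_le_div {Ω : Type*} [MeasurableSpace Ω] {ι : Type*} {μ : Measure Ω}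
    [IsFiniteMeasure μ] {q : ι → Ω → ℝ} (h : PRD μ q) {D : Set (ι → ℝ)}
    (hD : IsIncreasingSet D) (i : ι) {s t : ℝ} (hs : 0 < s) (hst : s ≤ t) (ht : t ≤ 1) :
    μ.real ({ω | (fun j => q j ω) ∈ D} ∩ {ω | q i ω ≤ s}) / μ.real {ω | q i ω ≤ s} ≤
      μ.real ({ω | (fun j => q j ω) ∈ D} ∩ {ω | q i ω ≤ t}) / μ.real {ω | q i ω ≤ t} := by
  rcases (measureReal_nonneg (μ := μ) (s := {ω | q i ω ≤ s})).eq_or_lt with h0 | h0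
  · rw [← h0, div_zero]
    positivity
  · have hpos : 0 < μ.real {ω | q i ω ≤ t} :=
      h0.trans_le (measureReal_mono fun ω hω => le_trans hω hst)
    rw [div_le_div_iff₀ h0 hpos]
    have := ENNReal.toReal_mono (by finiteness) (h D hD i s t hs hst ht)
    simpa only [ENNReal.toReal_mul, Measure.real] using this

/-- **Simes' inequality** under positive regression dependence. -/
theorem PRD.simes {Ω : Type*} [MeasurableSpace Ω] {μ : Measure Ω} [IsProbabilityMeasure μ]
    {ι : Type*} [Fintype ι] [Nonempty ι] {q : ι → Ω → ℝ} (h : PRD μ q)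
    (hmeas : ∀ i, Measurable (q i)) (hrange : ∀ i ω, q i ω ∈ Set.Icc (0 : ℝ) 1)
    (hunif : ∀ i, ∀ t ∈ Set.Icc (0 : ℝ) 1, μ {ω | q i ω ≤ t} ≤ ENNReal.ofReal t)
    {β : ℝ} (hβ : 0 < β) (hβ1 : β ≤ 1) :
    μ.real {ω | ∃ j : ℕ, 0 < j ∧
      j ≤ (Finset.univ.filter (fun i => q i ω ≤ β * (j : ℝ) / (Fintype.card ι : ℝ))).card} ≤
      β := by
  set m := Fintype.card ι with hm
  have hm0 : (0 : ℝ) < m := by exact_mod_cast Fintype.card_pos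
  set t : ℕ → ℝ := fun k => β * k / m with ht
  set G : ℕ → Set Ω := fun k => {ω | (fun j => q j ω) ∈ stepUpLeSet β k} with hG
  set A : ℕ → ι → Set Ω := fun k i => {ω | q i ω ≤ t k} with hA
  have hGm : ∀ k, MeasurableSet (G k) := fun k =>
    (measurable_pi_lambda _ hmeas) (measurableSet_stepUpLeSet β k)
  have hAm : ∀ k i, MeasurableSet (A k i) := fun k i =>
    measurableSet_le (hmeas i) measurable_const
  have hGsub : ∀ k, G k ⊆ G (k + 1) := fun k ω hω => stepUpLeSet_subset_succ β k hω
  have htpos : ∀ k, 0 < t (k + 1) := fun k => by simp only [ht]; positivity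
  have htmono : ∀ k, t k ≤ t (k + 1) := fun k => by
    simp only [ht]; gcongr; simp
  have htone : ∀ k ≤ m, t k ≤ 1 := fun k hk => by
    have hk' : (k : ℝ) ≤ m := by exact_mod_cast hk
    simp only [ht]
    rw [div_le_one hm0]
    nlinarith [(Nat.cast_nonneg k : (0 : ℝ) ≤ k)]
  have hsub : {ω | ∃ j : ℕ, 0 < j ∧ j ≤ (Finset.univ.filter (fun i => q i ω ≤ t j)).card} ⊆
      G m \ G 0 := by
    rintro ω ⟨j, hj0, hj⟩
    refine ⟨⟨fun i => hrange i ω, fun j hj => by simp [← hm] at hj⟩, fun hω => ?_⟩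
    have hjm : j ≤ m := hj.trans (Finset.card_le_univ _)
    exact absurd (hω.2 j (by simp [← hm, hj0, hjm])) (not_lt.mpr hj)
  have htel : μ.real (G m \ G 0) = ∑ k ∈ Finset.range m, μ.real (G (k + 1) \ G k) := by
    have hmono : G 0 ⊆ G m := monotone_nat_of_le_succ hGsub (Nat.zero_le m)
    rw [measureReal_sdiff hmono (hGm 0),
      ← Finset.sum_range_sub (fun k => μ.real (G k)) m]
    exact Finset.sum_congr rfl fun k _ => (measureReal_sdiff (hGsub k) (hGm k)).symm
  have hcount : ∀ k, ((k + 1 : ℕ) : ℝ) * μ.real (G (k + 1) \ G k) ≤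
      ∑ i, μ.real ((G (k + 1) \ G k) ∩ A (k + 1) i) := fun k =>
    nsmul_measureReal_le_sum_inter μ ((hGm _).diff (hGm _)) (hAm (k + 1))
      fun ω hω => le_card_of_mem_stepUpLeSet_diff hω.1 hω.2
  have hdiff : ∀ k i, μ.real ((G (k + 1) \ G k) ∩ A (k + 1) i) =
      μ.real (G (k + 1) ∩ A (k + 1) i) - μ.real (G k ∩ A (k + 1) i) := fun k i => by
    rw [← measureReal_sdiff (Set.inter_subset_inter_left _ (hGsub k))
      ((hGm k).inter (hAm _ i))]
    congr 1
    ext ω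
    simp only [Set.mem_inter_iff, Set.mem_sdiff]
    tauto
  have hcond : ∀ i, ∀ K ≤ m, ∑ k ∈ Finset.range K,
      μ.real ((G (k + 1) \ G k) ∩ A (k + 1) i) / μ.real (A (k + 1) i) ≤
        μ.real (G K ∩ A K i) / μ.real (A K i) := by
    intro i K hK
    induction K with
    | zero => simp only [Finset.range_zero, Finset.sum_empty]; positivity
    | succ K ih =>
      rw [Finset.sum_range_succ, hdiff, sub_div]
      suffices hS : ∑ k ∈ Finset.range K,
          μ.real ((G (k + 1) \ G k) ∩ A (k + 1) i) / μ.real (A (k + 1) i) ≤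
          μ.real (G K ∩ A (K + 1) i) / μ.real (A (K + 1) i) by linarith
      cases K with
      | zero => simp only [Finset.range_zero, Finset.sum_empty]; positivity
      | succ K =>
        exact (ih (by omega)).trans (h.div_le_div (isIncreasingSet_stepUpLeSet β _) i
          (htpos K) (htmono _) (htone _ hK))
  have hterm : ∀ i, ∀ k ∈ Finset.range m,
      μ.real ((G (k + 1) \ G k) ∩ A (k + 1) i) / ((k + 1 : ℕ) : ℝ) ≤
        β / m * (μ.real ((G (k + 1) \ G k) ∩ A (k + 1) i) / μ.real (A (k + 1) i)) := by
    intro i k hk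
    have hle : μ.real ((G (k + 1) \ G k) ∩ A (k + 1) i) ≤ μ.real (A (k + 1) i) :=
      measureReal_mono Set.inter_subset_right
    rcases (measureReal_nonneg (μ := μ) (s := A (k + 1) i)).eq_or_lt with h0 | h0
    · have : μ.real ((G (k + 1) \ G k) ∩ A (k + 1) i) = 0 :=
        le_antisymm (hle.trans_eq h0.symm) measureReal_nonneg
      simp [this]
    · have hF : μ.real (A (k + 1) i) ≤ t (k + 1) :=
        ENNReal.toReal_le_of_le_ofReal (htpos k).le
          (hunif i _ ⟨(htpos k).le, htone _ (by simpa using hk)⟩)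
      calc _ = β / m * (μ.real ((G (k + 1) \ G k) ∩ A (k + 1) i) / t (k + 1)) := by
            simp only [ht]; field_simp
        _ ≤ _ := by gcongr
  calc μ.real _ ≤ μ.real (G m \ G 0) := measureReal_mono hsub
    _ = ∑ k ∈ Finset.range m, μ.real (G (k + 1) \ G k) := htel
    _ ≤ ∑ k ∈ Finset.range m, ∑ i,
        μ.real ((G (k + 1) \ G k) ∩ A (k + 1) i) / ((k + 1 : ℕ) : ℝ) := by
      refine Finset.sum_le_sum fun k _ => ?_
      rw [← Finset.sum_div, le_div_iff₀ (by positivity), mul_comm]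
      exact hcount k
    _ = ∑ i, ∑ k ∈ Finset.range m,
        μ.real ((G (k + 1) \ G k) ∩ A (k + 1) i) / ((k + 1 : ℕ) : ℝ) := Finset.sum_comm
    _ ≤ ∑ _i : ι, β / m := by
      refine Finset.sum_le_sum fun i _ => (Finset.sum_le_sum (hterm i)).trans ?_
      rw [← Finset.mul_sum]
      refine mul_le_of_le_one_right (by positivity) ((hcond i m le_rfl).trans ?_)
      exact div_le_one_of_le₀ (measureReal_mono Set.inter_subset_right) measureReal_nonneg
    _ = β := by simp [← hm]; field_simp

/-- If the false discovery proportion of a compliant procedure is at least `x > 0`, then with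
`V` the number of rejected nulls, at least `V ≥ 1` null p-values satisfy the bound of the
step-up procedure on the nulls at level `π₀ α / x`. -/
lemma exists_le_card_of_le_procFDP {ι : Type*} [Fintype ι] {α x : ℝ} (hα : 0 ≤ α) (hx : 0 < x)
    {p : ι → ℝ} {N₀ S : Finset ι} (hS : IsCompliant α p S) (hle : x ≤ procFDP N₀ S) :
    ∃ j : ℕ, 0 < j ∧ j ≤ (Finset.univ.filter (fun i : {i // i ∈ N₀} =>
      p i.1 ≤ (N₀.card : ℝ) / Fintype.card ι * α / x * (j : ℝ) /
        (Fintype.card {i // i ∈ N₀} : ℝ))).card := by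
  have hV : 0 < (S ∩ N₀).card := by
    by_contra! h0
    simp [procFDP, Nat.le_zero.mp h0] at hle
    linarith
  refine ⟨_, hV, ?_⟩
  have hR : 0 < S.card := hV.trans_le (Finset.card_le_card Finset.inter_subset_left)
  have hN : (0 : ℝ) < N₀.card := by
    exact_mod_cast hV.trans_le (Finset.card_le_card Finset.inter_subset_right)
  have hR' : (0 : ℝ) < S.card := by exact_mod_cast hR
  have hxR : x * S.card ≤ (S ∩ N₀).card := by
    rwa [procFDP, max_eq_left (by omega), le_div_iff₀ hR'] at hle
  rw [← Finset.card_map (Function.Embedding.subtype (· ∈ N₀))]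
  refine Finset.card_le_card fun i hi => ?_
  obtain ⟨hiS, hiN⟩ := Finset.mem_inter.mp hi
  simp only [Finset.mem_map, Finset.mem_filter, Finset.mem_univ, true_and,
    Function.Embedding.coe_subtype, Subtype.exists, exists_and_right, exists_eq_right]
  refine ⟨hiN, (hS i hiS).trans ?_⟩
  have hn : (0 : ℝ) < Fintype.card ι := by
    exact_mod_cast hR.trans_le (Finset.card_le_univ S)
  rw [Fintype.card_coe]
  calc α * S.card / Fintype.card ι
      ≤ α * ((S ∩ N₀).card / x) / Fintype.card ι := by
        gcongr
        rwa [le_div_iff₀ hx, mul_comm]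
    _ = _ := by field_simp

lemma procFDP_nonneg {ι : Type*} (N₀ S : Finset ι) : 0 ≤ procFDP N₀ S := by
  unfold procFDP
  positivity

lemma procFDP_le_one {ι : Type*} (N₀ S : Finset ι) : procFDP N₀ S ≤ 1 := by
  refine div_le_one_of_le₀ ?_ (Nat.cast_nonneg _)
  exact_mod_cast (Finset.card_le_card Finset.inter_subset_left).trans (le_max_left _ _)

/-- A `[0,1]`-valued random variable whose tail at `x ≥ c` is at most `c / x` has expectation
at most `c + c log (1 / c)`. -/
lemma integral_le_of_tail_le_div {Ω : Type*} [MeasurableSpace Ω] {μ : Measure Ω}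
    [IsProbabilityMeasure μ] {f : Ω → ℝ} (hf : Measurable f) (hf0 : ∀ ω, 0 ≤ f ω)
    (hf1 : ∀ ω, f ω ≤ 1) {c : ℝ} (hc : 0 < c) (hc1 : c ≤ 1)
    (htail : ∀ x, c ≤ x → μ.real {ω | x ≤ f ω} ≤ c / x) :
    ∫ ω, f ω ∂μ ≤ c + c * Real.log (1 / c) := by
  have hint : Integrable f μ := Integrable.of_bound hf.aestronglyMeasurable 1
    (ae_of_all _ fun ω => by rw [Real.norm_of_nonneg (hf0 ω)]; exact hf1 ω)
  have hanti : Antitone fun x => μ.real {ω | x ≤ f ω} := fun x y hxy =>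
    measureReal_mono fun ω hω => le_trans hxy hω
  have hII : ∀ a b, IntervalIntegrable (fun x => μ.real {ω | x ≤ f ω}) volume a b :=
    fun a b => hanti.intervalIntegrable
  rw [hint.integral_eq_integral_Ioc_meas_le (M := 1) (ae_of_all _ hf0) (ae_of_all _ hf1),
    ← intervalIntegral.integral_of_le zero_le_one,
    ← intervalIntegral.integral_add_adjacent_intervals (hII 0 c) (hII c 1)]
  have h1 : ∫ x in (0 : ℝ)..c, μ.real {ω | x ≤ f ω} ≤ c := by
    calc _ ≤ ∫ _x in (0 : ℝ)..c, (1 : ℝ) :=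
          intervalIntegral.integral_mono_on hc.le (hII 0 c) (by simp)
            fun x _ => measureReal_le_one
      _ = c := by simp
  have h0 : (0 : ℝ) ∉ Set.uIcc c 1 := Set.notMem_uIcc_of_lt hc one_pos
  have h2 : ∫ x in c..1, μ.real {ω | x ≤ f ω} ≤ c * Real.log (1 / c) := by
    have hII' : IntervalIntegrable (fun x : ℝ => c * (1 / x)) volume c 1 :=
      (intervalIntegral.intervalIntegrable_one_div (fun x hx hx0 => h0 (hx0 ▸ hx))
        continuousOn_id).const_mul c
    calc _ ≤ ∫ x in c..1, c * (1 / x) :=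
          intervalIntegral.integral_mono_on hc1 (hII c 1) hII'
            fun x hx => by rw [mul_one_div]; exact htail x hx.1
      _ = _ := by rw [intervalIntegral.integral_const_mul, integral_one_div h0]
  exact add_le_add h1 h2

/-- If the p-values satisfy the PRDN property, then every multiple testing procedure
compliant at level `α ∈ (0,1)` satisfies the strengthened bound
`FDR ≤ π₀ α + π₀ α log(1/(π₀ α))`, where `π₀ = n₀/n` is the true null proportion. -/
theorem fdr_control_PRDN_strengthened
    {Ω : Type*} [MeasurableSpace Ω] (μ : Measure Ω) [IsProbabilityMeasure μ]
    {n : ℕ} (hn : 0 < n) (p : Fin n → Ω → ℝ)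
    (hmeas : ∀ i, Measurable (p i))
    (hrange : ∀ i ω, p i ω ∈ Set.Icc (0:ℝ) 1)
    (N₀ : Finset (Fin n)) (hN₀ : 0 < N₀.card)
    (hnull : ∀ i ∈ N₀, ∀ t ∈ Set.Icc (0:ℝ) 1, μ {ω | p i ω ≤ t} ≤ ENNReal.ofReal t)
    (hPRDN : PRDN μ N₀ p)
    {α : ℝ} (hα : 0 < α) (hα1 : α < 1)
    (proc : Ω → Finset (Fin n))
    (hcomp : ∀ ω, IsCompliant α (fun i => p i ω) (proc ω))
    (hmeasFDP : Measurable fun ω => procFDP N₀ (proc ω)) :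
    (∫ ω, procFDP N₀ (proc ω) ∂μ) ≤
      (N₀.card : ℝ) / n * α +
        (N₀.card : ℝ) / n * α * Real.log (1 / ((N₀.card : ℝ) / n * α)) := by
  set c : ℝ := (N₀.card : ℝ) / n * α with hc
  have hn' : (0 : ℝ) < n := by exact_mod_cast hn
  have hN' : (0 : ℝ) < N₀.card := by exact_mod_cast hN₀
  have hc0 : 0 < c := by positivity
  have hNn : (N₀.card : ℝ) / n ≤ 1 := by
    rw [div_le_one hn']
    exact_mod_cast (Finset.card_le_univ N₀).trans_eq (Fintype.card_fin n)
  have hc1 : c ≤ 1 := mul_le_one₀ hNn hα.le hα1.le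
  have : Nonempty {i // i ∈ N₀} := (Finset.card_pos.mp hN₀).to_subtype
  refine integral_le_of_tail_le_div hmeasFDP (fun ω => procFDP_nonneg _ _)
    (fun ω => procFDP_le_one _ _) hc0 hc1 fun x hx => ?_
  have hx0 : 0 < x := hc0.trans_le hx
  refine le_trans (measureReal_mono fun ω hω => ?_)
    (PRD.simes (q := fun (i : {i // i ∈ N₀}) ω => p i.1 ω) hPRDN (fun i => hmeas i.1)
      (fun i => hrange i.1) (fun i => hnull i.1 i.2) (div_pos hc0 hx0)
      ((div_le_one hx0).mpr hx))
  have hV := exists_le_card_of_le_procFDP hα.le hx0 (hcomp ω) hω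
  rwa [Fintype.card_fin] at hV
end

section
/- Let F : (0,1) → [0,1] be non-decreasing and right-continuous. Then the function f(t) = t + t·∫_{t}^{1} F(x)/x² dx is non-decreasing in t on (0,1). -/
open MeasureTheory

lemma integrableOn_const_div_sq {a b : ℝ} (ha : 0 < a) (c : ℝ) :
    IntegrableOn (fun x : ℝ => c / x ^ 2) (Set.Ioc a b) := by
  have h : ContinuousOn (fun x : ℝ => c / x ^ 2) (Set.Icc a b) := by
    refine continuousOn_const.div (by fun_prop) fun x hx => ?_
    have : 0 < x := ha.trans_le hx.1
    positivity
  exact h.integrableOn_Icc.mono_set Set.Ioc_subset_Icc_self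

lemma setIntegral_const_div_sq {a b : ℝ} (ha : 0 < a) (hab : a ≤ b) (c : ℝ) :
    ∫ x in Set.Ioc a b, c / x ^ 2 = c * (1 / a - 1 / b) := by
  have hpos : ∀ x ∈ Set.uIcc a b, 0 < x := fun x hx => by
    rw [Set.uIcc_of_le hab] at hx
    exact ha.trans_le hx.1
  rw [← intervalIntegral.integral_of_le hab,
    intervalIntegral.integral_eq_sub_of_hasDerivAt (f := fun x => -c * x⁻¹)]
  · ring
  · intro x hx
    have hderiv : c / x ^ 2 = -c * -(x ^ 2)⁻¹ := by ring
    rw [hderiv]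
    exact (hasDerivAt_inv (hpos x hx).ne').const_mul (-c)
  · exact (intervalIntegrable_iff_integrableOn_Ioc_of_le hab).2
      (integrableOn_const_div_sq ha c)

lemma integrableOn_div_sq_of_monotoneOn {F : ℝ → ℝ} {s : ℝ} (hs : 0 < s)
    (hmono : MonotoneOn F (Set.Ioo s 1))
    (hrange : ∀ x ∈ Set.Ioo s 1, F x ∈ Set.Icc (0 : ℝ) 1) :
    IntegrableOn (fun x => F x / x ^ 2) (Set.Ioo s 1) := by
  refine Integrable.mono' ((integrableOn_const_div_sq (b := 1) hs 1).mono_set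
    Set.Ioo_subset_Ioc_self) ?_ ?_
  · exact ((aemeasurable_restrict_of_monotoneOn measurableSet_Ioo hmono).div
      (by fun_prop)).aestronglyMeasurable
  · filter_upwards [ae_restrict_mem measurableSet_Ioo] with x hx
    obtain ⟨h0, h1⟩ := hrange x hx
    rw [Real.norm_of_nonneg (by positivity)]
    gcongr

/-- Let `F : (0,1) → [0,1]` be non-decreasing and right-continuous. Then
`f(t) = t + t ⋅ ∫_t^1 F(x)/x² dx` is non-decreasing in `t` on `(0,1)`. -/
theorem monotone_fdr_linking_bound (F : ℝ → ℝ)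
    (hmono : MonotoneOn F (Set.Ioo 0 1))
    (hrc : ∀ t ∈ Set.Ioo (0:ℝ) 1, ContinuousWithinAt F (Set.Ici t) t)
    (hrange : ∀ x ∈ Set.Ioo (0:ℝ) 1, F x ∈ Set.Icc (0:ℝ) 1) :
    MonotoneOn (fun t => t + t * ∫ x in Set.Ioo t 1, F x / x ^ 2) (Set.Ioo 0 1) := by
  intro s hs t ht hst
  have hs0 : 0 < s := hs.1
  have ht0 : 0 < t := ht.1
  have hsub : Set.Ioo s 1 ⊆ Set.Ioo 0 1 := Set.Ioo_subset_Ioo_left hs0.le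
  have hint := integrableOn_div_sq_of_monotoneOn hs0 (hmono.mono hsub)
    fun x hx => hrange x (hsub hx)
  have hunion : Set.Ioc s t ∪ Set.Ioo t 1 = Set.Ioo s 1 :=
    Set.Ioc_union_Ioo_eq_Ioo hst ht.2
  have hleft : IntegrableOn (fun x => F x / x ^ 2) (Set.Ioc s t) :=
    hint.mono_set (hunion ▸ Set.subset_union_left)
  have hright : IntegrableOn (fun x => F x / x ^ 2) (Set.Ioo t 1) :=
    hint.mono_set (hunion ▸ Set.subset_union_right)
  have hsplit : ∫ x in Set.Ioo s 1, F x / x ^ 2 =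
      (∫ x in Set.Ioc s t, F x / x ^ 2) + ∫ x in Set.Ioo t 1, F x / x ^ 2 := by
    rw [← hunion]
    refine setIntegral_union ?_ measurableSet_Ioo hleft hright
    exact Set.disjoint_left.2 fun x hx hx' => hx'.1.not_ge hx.2
  have hupper : ∫ x in Set.Ioc s t, F x / x ^ 2 ≤ F t * (1 / s - 1 / t) := by
    rw [← setIntegral_const_div_sq hs0 hst]
    refine setIntegral_mono_on hleft (integrableOn_const_div_sq hs0 _) measurableSet_Ioc
      fun x hx => ?_
    have := hmono ⟨hs0.trans hx.1, hx.2.trans_lt ht.2⟩ ht hx.2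
    gcongr
  have hlower : F t * (1 / t - 1 / 1) ≤ ∫ x in Set.Ioo t 1, F x / x ^ 2 := by
    rw [← setIntegral_const_div_sq ht0 ht.2.le, integral_Ioc_eq_integral_Ioo]
    refine setIntegral_mono_on ((integrableOn_const_div_sq ht0 _).mono_set
      Set.Ioo_subset_Ioc_self) hright measurableSet_Ioo fun x hx => ?_
    have := hmono ht ⟨ht0.trans hx.1, hx.2⟩ hx.1.le
    gcongr
  have hF := (hrange t ht).2
  have h₁ := mul_le_mul_of_nonneg_left hupper hs0.le
  have h₂ := mul_le_mul_of_nonneg_left hlower (sub_nonneg.2 hst)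
  have h₃ := mul_nonneg (sub_nonneg.2 hst) (sub_nonneg.2 hF)
  have h₄ : s * (F t * (1 / s - 1 / t)) = (t - s) * (F t * (1 / t)) := by
    field_simp
  simp only [hsplit]
  linarith
end
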